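/- Let a, b ∈ ℤ. The following holds: the polynomial F(x) = x⁸ + a·x⁴ + b is monogenic, b is not a perfect square, and b(a² − 4b) is a perfect square, if and only if (a, b) ∈ {(−4, 2), (4, 2), (−5, 5)}, i.e., F(x) is one of x⁸ − 4x⁴ + 2, x⁸ + 4x⁴ + 2, x⁸ − 5x⁴ + 5. -/

import Mathlib

open Polynomial

/-- A monic polynomial `f ∈ ℤ[x]` is *monogenic* if it is irreducible over `ℚ` and,
for any number field `K` generated over `ℚ` by a root `θ` of `f`, the ring `ℤ[θ]`
is the full ring of integers (the integral closure of `ℤ`) of `K`. -/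
def IsMonogenic (f : Polynomial ℤ) : Prop :=
  f.Monic ∧ Irreducible (f.map (Int.castRingHom ℚ)) ∧
    ∀ (K : Type) [Field K] [NumberField K] (θ : K),
      Polynomial.aeval θ f = 0 →
      Algebra.adjoin ℚ {θ} = (⊤ : Subalgebra ℚ K) →
      Algebra.adjoin ℤ {θ} = integralClosure ℤ K

theorem minpoly_int_eq {f : ℤ[X]} (hf : f.Monic) (hirr : Irreducible (f.map (Int.castRingHom ℚ)))
    {K : Type} [Field K] [NumberField K] {θ : K} (hθ : aeval θ f = 0) : minpoly ℤ θ = f := by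
  have hint : IsIntegral ℤ θ := ⟨f, hf, by simpa [aeval_def] using hθ⟩
  have h : f.map (Int.castRingHom ℚ) = minpoly ℚ θ :=
    minpoly.eq_of_irreducible_of_monic hirr
      (by rw [← algebraMap_int_eq, aeval_map_algebraMap, hθ]) (hf.map _)
  rw [minpoly.isIntegrallyClosed_eq_field_fractions' ℚ hint, algebraMap_int_eq] at h
  exact (map_injective _ Int.cast_injective h).symm

/-- A number field generated by a root of an irreducible polynomial. -/
theorem exists_numberField_root {f : ℤ[X]} (hirr : Irreducible (f.map (Int.castRingHom ℚ))) :
    ∃ (K : Type) (_ : Field K) (_ : NumberField K) (θ : K),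
      aeval θ f = 0 ∧ Algebra.adjoin ℚ {θ} = (⊤ : Subalgebra ℚ K) := by
  have : Fact (Irreducible (f.map (Int.castRingHom ℚ))) := ⟨hirr⟩
  have : FiniteDimensional ℚ (AdjoinRoot (f.map (Int.castRingHom ℚ))) :=
    (AdjoinRoot.powerBasis hirr.ne_zero).finite
  have : CharZero (AdjoinRoot (f.map (Int.castRingHom ℚ))) :=
    algebraRat.charZero _
  refine ⟨AdjoinRoot (f.map (Int.castRingHom ℚ)), inferInstance, { }, AdjoinRoot.root _, ?_, ?_⟩
  · have h := AdjoinRoot.eval₂_root (f.map (Int.castRingHom ℚ))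
    rw [eval₂_map] at h
    rw [aeval_def, ← h]
    congr 1
  · rw [Subsingleton.elim (DivisionRing.toRatAlgebra :
      Algebra ℚ (AdjoinRoot (f.map (Int.castRingHom ℚ)))) (AdjoinRoot.instAlgebra _)]
    exact AdjoinRoot.adjoinRoot_eq_top

/-- The obstruction half of Dedekind's criterion: if `f` lies in the square of the ideal `(p, g)`,
then `f` is not monogenic. -/
theorem not_isMonogenic_of_eq {f g u v w : ℤ[X]} {p : ℤ} (hp0 : p ≠ 0) (hp : ¬ IsUnit p)
    (hg : g.Monic) (hu : u.Monic) (hdeg : (g * u).natDegree < f.natDegree)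
    (hf : f = g ^ 2 * u + C p * g * v + C p ^ 2 * w) : ¬ IsMonogenic f := by
  rintro ⟨hmon, hirr, h⟩
  obtain ⟨K, _, _, θ, hθ, htop⟩ := exists_numberField_root hirr
  have hA := h K θ hθ htop
  have hmin := minpoly_int_eq hmon hirr hθ
  have hpK : (p : K) ≠ 0 := by exact_mod_cast hp0
  set G := aeval θ g
  set U := aeval θ u
  set V := aeval θ v
  set W := aeval θ w
  have hrel : G ^ 2 * U + p * G * V + p ^ 2 * W = 0 := by
    rw [hf] at hθ
    simpa [G, U, V, W] using hθ
  have hI : ∀ q : ℤ[X], aeval θ q ∈ integralClosure ℤ K := fun q => by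
    rw [← hA]; exact aeval_mem_adjoin_singleton ℤ θ
  set α : K := (G * U + p * V) / p with hα
  have hquad : α ^ 2 - V * α + U * W = 0 := by
    rw [hα]; field_simp
    linear_combination U * hrel
  have hαint : α ∈ integralClosure ℤ K := by
    have : IsIntegral (integralClosure ℤ K) α := by
      refine ⟨X ^ 2 - C ⟨V, hI v⟩ * X + C (⟨U, hI u⟩ * ⟨W, hI w⟩), by monicity!, ?_⟩
      simpa [Algebra.algebraMap_eq_smul_one, Subalgebra.smul_def] using hquad
    exact isIntegral_trans (R := ℤ) (A := integralClosure ℤ K) α this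
  rw [← hA, Algebra.adjoin_singleton_eq_range_aeval] at hαint
  obtain ⟨t, ht⟩ := hαint
  replace ht : aeval θ t = α := ht
  have hzero : aeval θ (g * u - C p * (t %ₘ f - v %ₘ f)) = 0 := by
    have h1 : aeval θ (t %ₘ f) = α := by rw [aeval_modByMonic_eq_self_of_root hθ, ht]
    have h2 : aeval θ (v %ₘ f) = V := by rw [aeval_modByMonic_eq_self_of_root hθ]
    simp only [map_sub, map_mul, h1, h2, aeval_C, hα]
    simp only [eq_intCast]
    field_simp
    ring
  have hpoly : g * u - C p * (t %ₘ f - v %ₘ f) = 0 := by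
    by_contra hne
    have hle := minpoly.IsIntegrallyClosed.degree_le_of_ne_zero hne hzero
    rw [hmin] at hle
    refine absurd hle (not_le.2 ?_)
    refine (degree_sub_le _ _).trans_lt (max_lt (degree_lt_degree hdeg) ?_)
    rw [degree_C_mul hp0]
    exact (degree_sub_le _ _).trans_lt
      (max_lt (degree_modByMonic_lt _ hmon) (degree_modByMonic_lt _ hmon))
  have hc := congrArg (fun q => coeff q (g * u).natDegree) (sub_eq_zero.1 hpoly)
  simp only [coeff_C_mul] at hc
  rw [coeff_natDegree, (hg.mul hu).leadingCoeff] at hc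
  exact hp (IsUnit.of_mul_eq_one _ hc.symm)

theorem natDegree_X_pow_eight_add (a b : ℤ) :
    (X ^ 8 + C a * X ^ 4 + C b : ℤ[X]).natDegree = 8 := by
  compute_degree!

theorem isUnit_of_sq_dvd {a b p : ℤ} (h : IsMonogenic (X ^ 8 + C a * X ^ 4 + C b)) (hp0 : p ≠ 0)
    (hp : p * p ∣ b) : IsUnit p := by
  by_contra hu
  obtain ⟨n, rfl⟩ := hp
  refine not_isMonogenic_of_eq (g := X) (u := X ^ 6 + C a * X ^ 2) (v := 0) (w := C n) hp0 hu
    monic_X (by monicity!) ?_ ?_ h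
  · rw [natDegree_X_pow_eight_add]
    exact lt_of_le_of_lt (b := 7) (by compute_degree) (by norm_num)
  · simp only [map_mul]
    ring

theorem isUnit_of_odd_of_sq_dvd {a b p : ℤ} (h : IsMonogenic (X ^ 8 + C a * X ^ 4 + C b))
    (hp : Odd p) (hd : p ^ 2 ∣ a ^ 2 - 4 * b) : IsUnit p := by
  by_contra hu
  have hp0 : p ≠ 0 := by rintro rfl; simp at hp
  have hcop : IsCoprime (p ^ 2) 2 :=
    (Int.isCoprime_two_right.2 hp).pow_left
  obtain ⟨m, k, hmk⟩ : ∃ m k : ℤ, a = 2 * k + p ^ 2 * m := by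
    obtain ⟨x, y, hxy⟩ := hcop
    exact ⟨x * a, y * a, by linear_combination -a * hxy⟩
  obtain ⟨n, hn⟩ : p ^ 2 ∣ b - k ^ 2 := by
    have h4 : p ^ 2 ∣ 4 * (b - k ^ 2) := by
      obtain ⟨l, hl⟩ := hd
      exact ⟨-l + m * (a + 2 * k), by rw [mul_add, mul_neg, ← hl, hmk]; ring⟩
    have h22 : IsCoprime (p ^ 2) 4 := by
      have := hcop.mul_right hcop
      norm_num at this
      exact this
    exact h22.dvd_of_dvd_mul_left h4
  obtain rfl : b = k ^ 2 + p ^ 2 * n := by linear_combination hn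
  refine not_isMonogenic_of_eq (g := X ^ 4 + C k) (u := 1) (v := 0) (w := C m * X ^ 4 + C n) hp0 hu
    (by monicity!) monic_one ?_ ?_ h
  · rw [natDegree_X_pow_eight_add]
    exact lt_of_le_of_lt (b := 4) (by compute_degree) (by norm_num)
  · rw [hmk]
    simp only [map_mul, map_add, map_pow]
    rw [show (C 2 : ℤ[X]) = 2 from rfl]
    ring

theorem not_isMonogenic_of_mod_four {a b : ℤ} (hab : 4 ∣ 1 + a + b) :
    ¬ IsMonogenic (X ^ 8 + C a * X ^ 4 + C b) := by
  obtain ⟨n, hn⟩ := hab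
  obtain rfl : b = 4 * n - 1 - a := by linear_combination hn
  refine not_isMonogenic_of_eq (p := 2) (g := X - 1)
    (u := X ^ 6 + 2 * X ^ 5 + 3 * X ^ 4 + 4 * X ^ 3 + 5 * X ^ 2 + 6 * X + 7
      + C a * (X ^ 2 + 2 * X + 3)) (v := 4 + 2 * C a) (w := C n) (by norm_num)
    (by decide) (by monicity!) (by monicity!) ?_ ?_
  · rw [natDegree_X_pow_eight_add]
    exact lt_of_le_of_lt (b := 7) (by compute_degree) (by norm_num)
  · simp only [map_sub, map_mul, map_one]
    rw [show (C 2 : ℤ[X]) = 2 from rfl, show (C 4 : ℤ[X]) = 4 from rfl]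
    ring

theorem not_isMonogenic_five_five : ¬ IsMonogenic (X ^ 8 + C 5 * X ^ 4 + C 5) := by
  refine not_isMonogenic_of_eq (p := 2) (g := X ^ 2 + X + 1)
    (u := X ^ 4 - 2 * X ^ 3 + X ^ 2 + 2 * X + 1) (v := -4 * X) (w := X + 1) (by norm_num)
    (by decide) (by monicity!) (by monicity!) ?_ ?_
  · rw [natDegree_X_pow_eight_add]
    exact lt_of_le_of_lt (b := 6) (by compute_degree) (by norm_num)
  · rw [show (C 2 : ℤ[X]) = 2 from rfl, show (C 5 : ℤ[X]) = 5 from rfl]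
    ring

theorem eq_of_mul_sq_eq {p b c : ℤ} (hp : Prime p) (h : b * c ^ 2 = p) : b = p ∧ c ^ 2 = 1 := by
  have hu : IsUnit c := hp.irreducible.squarefree c ⟨b, by linear_combination -h⟩
  have hc : c ^ 2 = 1 := by rw [sq]; exact Int.isUnit_mul_self hu
  exact ⟨by simpa [hc] using h, hc⟩

theorem eq_of_isMonogenic {a b : ℤ} (h : IsMonogenic (X ^ 8 + C a * X ^ 4 + C b))
    (hb : ¬ IsSquare b) (hsq : IsSquare (b * (a ^ 2 - 4 * b))) :
    (a = -4 ∧ b = 2) ∨ (a = 4 ∧ b = 2) ∨ (a = -5 ∧ b = 5) := by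
  have hb0 : b ≠ 0 := by rintro rfl; exact hb ⟨0, by simp⟩
  have hsf : Squarefree b := fun p hp =>
    isUnit_of_sq_dvd h (by rintro rfl; exact hb0 (by simpa using hp)) hp
  obtain ⟨s, hs⟩ := hsq
  obtain ⟨d, rfl⟩ : b ∣ s :=
    (hsf.dvd_pow_iff_dvd two_ne_zero).1 ⟨a ^ 2 - 4 * b, by linear_combination -hs⟩
  have hdisc : a ^ 2 - 4 * b = b * d ^ 2 :=
    mul_left_cancel₀ hb0 (by linear_combination hs)
  obtain ⟨c, rfl⟩ : b ∣ a :=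
    (hsf.dvd_pow_iff_dvd two_ne_zero).1 ⟨d ^ 2 + 4, by linear_combination hdisc⟩
  have hc : b * c ^ 2 = d ^ 2 + 4 := mul_left_cancel₀ hb0 (by linear_combination hdisc)
  have hunit : ∀ p, Odd p → p ∣ d → p ^ 2 = 1 := fun p hp hpd =>
    Int.isUnit_iff.1 (isUnit_of_odd_of_sq_dvd h hp
      (hdisc ▸ Dvd.dvd.mul_left (pow_dvd_pow_of_dvd hpd 2) b)) |>.elim
      (by rintro rfl; rfl) (by rintro rfl; rfl)
  rcases Int.even_or_odd' d with ⟨e, rfl | rfl⟩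
  · obtain ⟨c, rfl⟩ : 2 ∣ c := by
      by_contra hodd
      have hcop : IsCoprime (2 * 2) (c ^ 2) := by
        have h2 : IsCoprime 2 c := Int.isCoprime_two_left.2 (by grind)
        exact (h2.mul_left h2).pow_right
      have h4 : 2 * 2 ∣ b :=
        hcop.dvd_of_dvd_mul_right ⟨e ^ 2 + 1, by linear_combination hc⟩
      exact absurd (hsf 2 h4) (by decide)
    have he : b * c ^ 2 = e ^ 2 + 1 := by linarith
    rcases Int.even_or_odd' e with ⟨m, rfl | rfl⟩
    · refine absurd h (not_isMonogenic_of_mod_four ?_)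
      rcases Int.even_or_odd' c with ⟨k, rfl | rfl⟩
      · have : 2 * (2 * (b * k ^ 2)) = 2 * (2 * m ^ 2) + 1 := by linear_combination he
        omega
      · exact ⟨1 + 3 * m ^ 2 - 3 * b * k ^ 2 - 2 * b * k, by linear_combination 3 * he⟩
    · have h1 := hunit _ ⟨m, rfl⟩ (Dvd.intro_left _ rfl)
      rw [h1] at he
      have hb2 := eq_of_mul_sq_eq Int.prime_two he
      obtain rfl | rfl := sq_eq_one_iff.1 hb2.2
      · simp [hb2.1]
      · simp [hb2.1]
  · have h1 := hunit _ ⟨e, rfl⟩ dvd_rfl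
    rw [h1] at hc
    obtain ⟨rfl, hc1⟩ := eq_of_mul_sq_eq (p := 5) (by norm_num) hc
    obtain rfl | rfl := sq_eq_one_iff.1 hc1
    · exact absurd h not_isMonogenic_five_five
    · simp

section

variable {K : Type} [Field K] [NumberField K] {θ : K} {f : ℤ[X]}

theorem aeval_derivative_mul_mem_adjoin (hf : f.Monic)
    (hirr : Irreducible (f.map (Int.castRingHom ℚ))) (hθ : aeval θ f = 0)
    (htop : Algebra.adjoin ℚ {θ} = (⊤ : Subalgebra ℚ K)) {z : K} (hz : IsIntegral ℤ z) :
    aeval θ (derivative f) * z ∈ Algebra.adjoin ℤ {θ} := by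
  have hint : IsIntegral ℤ θ := ⟨f, hf, by simpa [aeval_def] using hθ⟩
  have hmem : z ∈ (Algebra.traceForm ℚ K).dualSubmodule
      (Subalgebra.toSubmodule (Algebra.adjoin ℤ {θ})) := by
    rw [LinearMap.BilinForm.mem_dualSubmodule]
    intro y hy
    have hyint : IsIntegral ℤ y := adjoin_le_integralClosure hint hy
    rw [Algebra.traceForm_apply, Submodule.mem_one]
    exact IsIntegrallyClosed.isIntegral_iff.1 (Algebra.isIntegral_trace (hz.mul hyint))
  rw [traceForm_dualSubmodule_adjoin ℤ ℚ htop hint,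
    minpoly.isIntegrallyClosed_eq_field_fractions' ℚ hint, minpoly_int_eq hf hirr hθ,
    derivative_map, aeval_map_algebraMap] at hmem
  have hne : aeval θ (derivative f) ≠ 0 := by
    have := (Algebra.IsSeparable.isSeparable ℚ θ).aeval_derivative_ne_zero (minpoly.aeval ℚ θ)
    rwa [minpoly.isIntegrallyClosed_eq_field_fractions' ℚ hint, minpoly_int_eq hf hirr hθ,
      derivative_map, aeval_map_algebraMap] at this
  obtain ⟨y, hy, rfl⟩ := hmem
  simpa [hne] using hy

theorem mem_adjoin_of_pow_mul_mem_adjoin (hf : f.Monic)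
    (hirr : Irreducible (f.map (Int.castRingHom ℚ))) (hθ : aeval θ f = 0)
    (htop : Algebra.adjoin ℚ {θ} = (⊤ : Subalgebra ℚ K)) {p : ℤ} (hp : Prime p)
    (hei : f.IsEisensteinAt (Ideal.span {p})) {z : K} (hz : IsIntegral ℤ z) {n : ℕ}
    (hn : (p : K) ^ n * z ∈ Algebra.adjoin ℤ {θ}) : z ∈ Algebra.adjoin ℤ {θ} := by
  have hint : IsIntegral ℤ θ := ⟨f, hf, by simpa [aeval_def] using hθ⟩
  refine mem_adjoin_of_smul_prime_pow_smul_of_minpoly_isEisensteinAt (K := ℚ)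
    (B := PowerBasis.ofAdjoinEqTop hint.tower_top htop) hp hint (n := n) hz ?_ ?_
  · simpa [zsmul_eq_mul] using hn
  · rw [PowerBasis.ofAdjoinEqTop_gen, minpoly_int_eq hf hirr hθ]
    exact hei

end

theorem monic_X_pow_eight_add (a b : ℤ) : (X ^ 8 + C a * X ^ 4 + C b : ℤ[X]).Monic := by
  monicity!

theorem isEisensteinAt_X_pow_eight_add {a b p : ℤ} (hp : Prime p) (ha : p ∣ a) (hb : p ∣ b)
    (hb2 : ¬ p ^ 2 ∣ b) : (X ^ 8 + C a * X ^ 4 + C b : ℤ[X]).IsEisensteinAt (Ideal.span {p}) where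
  leading := by
    rw [monic_X_pow_eight_add a b, Ideal.mem_span_singleton]
    exact hp.not_dvd_one
  mem := by
    intro n hn
    rw [natDegree_X_pow_eight_add] at hn
    rw [Ideal.mem_span_singleton]
    simp only [coeff_add, coeff_C_mul, coeff_X_pow, coeff_C, hn.ne, if_false, zero_add]
    exact dvd_add (ha.mul_right _) (by split_ifs <;> simp [hb])
  notMem := by
    rw [Ideal.span_singleton_pow, Ideal.mem_span_singleton]
    simpa using hb2

theorem Polynomial.IsEisensteinAt.irreducible_map_rat {f : ℤ[X]} {p : ℤ} (hp : Prime p)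
    (hf : f.Monic) (hdeg : 0 < f.natDegree) (hei : f.IsEisensteinAt (Ideal.span {p})) :
    Irreducible (f.map (Int.castRingHom ℚ)) :=
  (hf.irreducible_iff_irreducible_map_fraction_map (K := ℚ)).1
    (hei.irreducible ((Ideal.span_singleton_prime hp.ne_zero).2 hp) hf.isPrimitive hdeg)

section

variable {K : Type} [Field K] [NumberField K] {θ : K}

theorem four_mul_mul_mem_adjoin {a b : ℤ}
    (hirr : Irreducible ((X ^ 8 + C a * X ^ 4 + C b : ℤ[X]).map (Int.castRingHom ℚ)))
    (hθ : aeval θ (X ^ 8 + C a * X ^ 4 + C b : ℤ[X]) = 0)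
    (htop : Algebra.adjoin ℚ {θ} = (⊤ : Subalgebra ℚ K)) {z : K} (hz : IsIntegral ℤ z) :
    (4 * b ^ 3 * (a ^ 2 - 4 * b) : K) * z ∈ Algebra.adjoin ℤ {θ} := by
  have h := mul_mem (aeval_mem_adjoin_singleton ℤ θ
      (p := (-(X ^ 7 + C a * X ^ 3)) ^ 3 * (2 * X ^ 4 + C a)))
    (aeval_derivative_mul_mem_adjoin (monic_X_pow_eight_add a b) hirr hθ htop hz)
  convert h using 1
  have hθ' : θ ^ 8 + a * θ ^ 4 + b = 0 := by simpa using hθ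
  have h1 : θ * -(θ ^ 7 + a * θ ^ 3) = b := by linear_combination -hθ'
  have h2 : (2 * θ ^ 4 + a) ^ 2 = (a : K) ^ 2 - 4 * b := by linear_combination 4 * hθ'
  rw [← h2, ← h1]
  simp [map_ofNat]
  ring

theorem irreducible_X_sq_add_X_add_one : Irreducible (X ^ 2 + X + 1 : (ZMod 2)[X]) := by
  have hdeg : (X ^ 2 + X + 1 : (ZMod 2)[X]).natDegree = 2 := by compute_degree!
  refine irreducible_of_degree_le_three_of_not_isRoot (by simp [hdeg]) fun x => ?_
  rw [IsRoot.def]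
  simp only [eval_add, eval_pow, eval_X, eval_one]
  revert x
  decide

theorem two_mul_ne_one_of_isIntegral {x : K} (hx : IsIntegral ℤ x) : 2 * x ≠ 1 := by
  intro h
  have hx2 : x = algebraMap ℚ K (1 / 2) := by
    rw [map_div₀, map_one, map_ofNat]
    linear_combination h / 2
  rw [hx2, isIntegral_algebraMap_iff (algebraMap ℚ K).injective] at hx
  obtain ⟨n, hn⟩ := IsIntegrallyClosed.isIntegral_iff.1 hx
  have h2n : (2 * n : ℚ) = 1 := by
    rw [algebraMap_int_eq, eq_intCast] at hn
    rw [hn]; norm_num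
  have : 2 * n = 1 := by exact_mod_cast h2n
  omega

theorem two_mul_ne_cube (hθ : θ ^ 8 - 5 * θ ^ 4 + 5 = 0) {η : K} (hη : IsIntegral ℤ η) :
    2 * η ≠ (θ ^ 2 + θ + 1) ^ 3 := by
  intro hcube
  have hint : IsIntegral ℤ θ :=
    ⟨_, monic_X_pow_eight_add (-5) 5, by simpa [sub_eq_add_neg] using hθ⟩
  have hnum : ∀ n : ℤ, IsIntegral ℤ (n : K) := fun n => isIntegral_algebraMap (R := ℤ) (x := n)
  obtain ⟨r, hr⟩ : ∃ r, r = 2 - 2 * θ - 5 * θ ^ 2 - 8 * θ ^ 3 - 12 * θ ^ 4 - 8 * θ ^ 5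
      - 5 * θ ^ 6 - 2 * θ ^ 7 := ⟨_, rfl⟩
  have hg4 : (θ ^ 2 + θ + 1) ^ 4 = -2 * r := by rw [hr]; linear_combination hθ
  have hr3 : r ^ 3 = -(2 * η ^ 4) := by
    have h8 : 8 * r ^ 3 = 8 * -(2 * η ^ 4) := by
      calc 8 * r ^ 3 = -(-2 * r) ^ 3 := by ring
        _ = -((θ ^ 2 + θ + 1) ^ 3) ^ 4 := by rw [← hg4]; ring
        _ = 8 * -(2 * η ^ 4) := by rw [← hcube]; ring
    exact mul_left_cancel₀ (by norm_num) h8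
  obtain ⟨m, hm⟩ : ∃ m : ℤ[X], m = C 12 + C 5 * X + X ^ 2 - X ^ 3 - C 15 * X ^ 4 - C 9 * X ^ 5
      - C 6 * X ^ 6 - C 4 * X ^ 7 := ⟨_, rfl⟩
  have hmint : IsIntegral ℤ (aeval θ m) :=
    adjoin_le_integralClosure hint (aeval_mem_adjoin_singleton ℤ θ)
  have hrm : r * θ ^ 2 = 1 + 2 * aeval θ m := by
    rw [hr, hm]
    simp only [map_sub, map_add, map_mul, map_pow, aeval_X, eq_intCast]
    push_cast
    simp only [map_ofNat]
    linear_combination (-5 - 2 * θ) * hθ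
  generalize aeval θ m = μ at hmint hrm
  refine two_mul_ne_one_of_isIntegral
    (x := -(η ^ 4 * θ ^ 6 + (3 : ℤ) * μ + (6 : ℤ) * μ ^ 2 + (4 : ℤ) * μ ^ 3)) ?_ ?_
  · exact (((((hη.pow 4).mul (hint.pow 6)).add ((hnum 3).mul hmint)).add
      ((hnum 6).mul (hmint.pow 2))).add ((hnum 4).mul (hmint.pow 3))).neg
  · have h3 : r ^ 3 * θ ^ 6 = (1 + 2 * μ) ^ 3 := by rw [← hrm]; ring
    push_cast
    linear_combination h3 - θ ^ 6 * hr3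

theorem mem_adjoin_of_two_mul_mem_adjoin
    (hθ : aeval θ (X ^ 8 + C (-5) * X ^ 4 + C 5 : ℤ[X]) = 0) {z : K} (hz : IsIntegral ℤ z)
    (h2 : 2 * z ∈ Algebra.adjoin ℤ {θ}) : z ∈ Algebra.adjoin ℤ {θ} := by
  have hθ' : θ ^ 8 - 5 * θ ^ 4 + 5 = 0 := by
    simpa [sub_eq_add_neg, map_ofNat] using hθ
  have hint : IsIntegral ℤ θ := ⟨_, monic_X_pow_eight_add (-5) 5, by simpa [aeval_def] using hθ⟩
  have haeval : ∀ q : ℤ[X], IsIntegral ℤ (aeval θ q) := fun q =>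
    adjoin_le_integralClosure hint (aeval_mem_adjoin_singleton ℤ θ)
  have hlift : ∀ q : ℤ[X], q.map (Int.castRingHom (ZMod 2)) = 0 → ∃ t : ℤ[X], q = 2 * t := by
    intro q hq
    have : (C 2 : ℤ[X]) ∣ q := by
      rw [C_dvd_iff_dvd_coeff]
      intro i
      have hcoeff := congrArg (coeff · i) hq
      exact (ZMod.intCast_zmod_eq_zero_iff_dvd _ 2).1 (by simpa using hcoeff)
    exact this
  have hsurj := map_surjective (Int.castRingHom (ZMod 2)) ZMod.intCast_surjective
  have hfmap : (X ^ 8 + C (-5) * X ^ 4 + C 5 : ℤ[X]).map (Int.castRingHom (ZMod 2)) =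
      (X ^ 2 + X + 1) ^ 4 := by
    have h : (X ^ 8 + C (-5) * X ^ 4 + C 5 : ℤ[X]) = (X ^ 2 + X + 1) ^ 4 + C 2 *
        (2 - 2 * X - 5 * X ^ 2 - 8 * X ^ 3 - 12 * X ^ 4 - 8 * X ^ 5 - 5 * X ^ 6 - 2 * X ^ 7) := by
      rw [C_neg, show (C 5 : ℤ[X]) = 5 from rfl, show (C 2 : ℤ[X]) = 2 from rfl]
      ring
    have h0 : (2 : ZMod 2) = 0 := by decide
    rw [h, Polynomial.map_add, Polynomial.map_mul, map_C]
    simp [h0]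
  rw [Algebra.adjoin_singleton_eq_range_aeval] at h2
  obtain ⟨y, hy⟩ := h2
  replace hy : aeval θ y = 2 * z := hy
  by_cases hdvd : (X ^ 2 + X + 1 : (ZMod 2)[X]) ^ 4 ∣ y.map (Int.castRingHom (ZMod 2))
  · obtain ⟨q, hq⟩ := hdvd
    obtain ⟨q, rfl⟩ := hsurj q
    obtain ⟨t, ht⟩ := hlift (y - (X ^ 8 + C (-5) * X ^ 4 + C 5) * q) (by
      rw [Polynomial.map_sub, Polynomial.map_mul, hfmap, hq, sub_self])
    have hev := congrArg (aeval θ) ht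
    rw [map_sub, map_mul, hθ, zero_mul, sub_zero, hy, map_mul, map_ofNat] at hev
    rw [mul_left_cancel₀ two_ne_zero hev]
    exact aeval_mem_adjoin_singleton ℤ θ
  · exfalso
    obtain ⟨s, t, hst⟩ : ∃ s t : (ZMod 2)[X], (X ^ 2 + X + 1) ^ 3 =
        s * y.map (Int.castRingHom (ZMod 2)) + t * (X ^ 2 + X + 1) ^ 4 := by
      obtain ⟨i, hi, hassoc⟩ := (dvd_prime_pow irreducible_X_sq_add_X_add_one.prime 4).1
        (EuclideanDomain.gcd_dvd_right (y.map (Int.castRingHom (ZMod 2))) _)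
      have hi3 : i ≤ 3 := by
        by_contra hlt
        obtain rfl : i = 4 := by omega
        exact hdvd (hassoc.symm.dvd.trans (EuclideanDomain.gcd_dvd_left _ _))
      obtain ⟨k, hk⟩ := hassoc.dvd.trans (pow_dvd_pow _ hi3)
      rw [EuclideanDomain.gcd_eq_gcd_ab] at hk
      exact ⟨EuclideanDomain.gcdA _ _ * k, EuclideanDomain.gcdB _ _ * k, by
        rw [hk, add_mul, mul_right_comm, mul_assoc, mul_comm, mul_assoc ((X ^ 2 + X + 1) ^ 4),
          mul_comm ((X ^ 2 + X + 1) ^ 4), mul_comm k]⟩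
    obtain ⟨s, rfl⟩ := hsurj s
    obtain ⟨t, rfl⟩ := hsurj t
    obtain ⟨w, hw⟩ := hlift ((X ^ 2 + X + 1) ^ 3 - s * y - t * (X ^ 8 + C (-5) * X ^ 4 + C 5)) (by
      rw [Polynomial.map_sub, Polynomial.map_sub, Polynomial.map_mul, Polynomial.map_mul, hfmap]
      simp [hst])
    have hev := congrArg (aeval θ) hw
    rw [map_sub, map_mul _ t, hθ] at hev
    simp only [map_sub, map_mul, hy, map_pow, map_add, map_one, aeval_X, map_ofNat] at hev
    exact two_mul_ne_cube hθ' (((haeval s).mul hz).add (haeval w)) (by linear_combination -hev)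

end

theorem isMonogenic_two {a : ℤ} (ha : a ^ 2 = 16) : IsMonogenic (X ^ 8 + C a * X ^ 4 + C 2) := by
  have h2a : (2 : ℤ) ∣ a := Int.prime_two.dvd_of_dvd_pow (n := 2) (by rw [ha]; norm_num)
  have hei := isEisensteinAt_X_pow_eight_add Int.prime_two h2a dvd_rfl (by norm_num)
  have hmon := monic_X_pow_eight_add a 2
  have hirr := hei.irreducible_map_rat Int.prime_two hmon
    (by rw [natDegree_X_pow_eight_add]; norm_num)
  refine ⟨hmon, hirr, fun K _ _ θ hθ htop => le_antisymm
    (adjoin_le_integralClosure ⟨_, hmon, by simpa [aeval_def] using hθ⟩) fun z hz => ?_⟩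
  refine mem_adjoin_of_pow_mul_mem_adjoin hmon hirr hθ htop Int.prime_two hei hz (n := 8) ?_
  have haK : (a : K) ^ 2 = 16 := by exact_mod_cast ha
  convert four_mul_mul_mem_adjoin hirr hθ htop hz using 2
  rw [haK]; norm_num

theorem isMonogenic_neg_five_five : IsMonogenic (X ^ 8 + C (-5) * X ^ 4 + C 5) := by
  have h5 : Prime (5 : ℤ) := by norm_num
  have hei := isEisensteinAt_X_pow_eight_add (a := -5) h5 (by norm_num) dvd_rfl (by norm_num)
  have hmon := monic_X_pow_eight_add (-5) 5
  have hirr := hei.irreducible_map_rat h5 hmon (by rw [natDegree_X_pow_eight_add]; norm_num)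
  refine ⟨hmon, hirr, fun K _ _ θ hθ htop => le_antisymm
    (adjoin_le_integralClosure ⟨_, hmon, by simpa [aeval_def] using hθ⟩) fun z hz => ?_⟩
  have h2int : IsIntegral ℤ (2 : K) := by
    simpa using isIntegral_algebraMap (R := ℤ) (A := K) (x := 2)
  refine mem_adjoin_of_two_mul_mem_adjoin hθ hz (mem_adjoin_of_two_mul_mem_adjoin hθ
    (h2int.mul hz) ?_)
  refine mem_adjoin_of_pow_mul_mem_adjoin hmon hirr hθ htop h5 hei
    (h2int.mul (h2int.mul hz)) (n := 4) ?_
  convert four_mul_mul_mem_adjoin hirr hθ htop hz using 1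
  push_cast
  ring

theorem stmt_13 (a b : ℤ) :
    (IsMonogenic (X ^ 8 + C a * X ^ 4 + C b) ∧ ¬ IsSquare b ∧
      IsSquare (b * (a ^ 2 - 4 * b))) ↔
    ((a = -4 ∧ b = 2) ∨ (a = 4 ∧ b = 2) ∨ (a = -5 ∧ b = 5)) := by
  refine ⟨fun ⟨h, hb, hsq⟩ => eq_of_isMonogenic h hb hsq, ?_⟩
  rintro (⟨rfl, rfl⟩ | ⟨rfl, rfl⟩ | ⟨rfl, rfl⟩)
  · exact ⟨isMonogenic_two (by norm_num), Int.prime_two.irreducible.not_isSquare, 4, by norm_num⟩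
  · exact ⟨isMonogenic_two (by norm_num), Int.prime_two.irreducible.not_isSquare, 4, by norm_num⟩
  · have h5 : Prime (5 : ℤ) := by norm_num
    exact ⟨isMonogenic_neg_five_five, h5.irreducible.not_isSquare, 5, by norm_num⟩
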